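/- Let n, p ≥ 1, let W_* ∈ ℝ^{n×n} be nonsingular, let C_* and C_0 be symmetric p-tensors on ℝ^n, and let s_0,…,s_{n−1} ∈ ℝ^n be nonzero steps such that the vectors W_*^{-1}s_0,…,W_*^{-1}s_{n−1} are pairwise orthogonal. For each k = 0,…,n−1 let C_{k+1} be the unique symmetric p-tensor minimizing ‖(C − C_k)[W_*]^p‖_F over all symmetric p-tensors C satisfying C[s_k] = C_*[s_k] (the higher-order secant update in the case where the p-th derivative is constantly equal to C_*, i.e. the objective is a p-th order polynomial). Then C_n = C_*. -/

import Mathlib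

open scoped BigOperators
open Matrix Filter

noncomputable section

/-- A `q`-tensor on `ℝ^n` (a multilinear map `(ℝ^n)^q → ℝ`), represented by its
coefficient array on the standard basis. -/
abbrev Tensor (n q : ℕ) := (Fin q → Fin n) → ℝ

namespace Tensor

/-- Evaluation of a tensor (as a multilinear map) on the vectors `u 0, …, u (q-1)`. -/
def eval {n q : ℕ} (T : Tensor n q) (u : Fin q → (Fin n → ℝ)) : ℝ :=
  ∑ i : Fin q → Fin n, T i * ∏ k, u k (i k)

/-- A tensor is symmetric if it is invariant under all permutations of its arguments. -/
def Symm {n q : ℕ} (T : Tensor n q) : Prop :=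
  ∀ σ : Equiv.Perm (Fin q), ∀ i : Fin q → Fin n, T (i ∘ σ) = T i

/-- The Frobenius norm of a tensor: the Euclidean norm of its coefficient array. -/
def frobNorm {n q : ℕ} (T : Tensor n q) : ℝ :=
  Real.sqrt (∑ i : Fin q → Fin n, (T i) ^ 2)

/-- The Frobenius inner product of two tensors. -/
def finner {n q : ℕ} (T S : Tensor n q) : ℝ := ∑ i : Fin q → Fin n, T i * S i

/-- The symmetric projection `P_sym(T) = (1/q!) ∑_σ σ(T)`. -/
def psym {n q : ℕ} (T : Tensor n q) : Tensor n q :=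
  fun i => ((Nat.factorial q : ℝ))⁻¹ * ∑ σ : Equiv.Perm (Fin q), T (i ∘ σ)

/-- `T[W]^q`: apply the matrix `W` to every argument of `T`. -/
def applyMat {n q : ℕ} (T : Tensor n q) (W : Matrix (Fin n) (Fin n) ℝ) : Tensor n q :=
  fun j => ∑ i : Fin q → Fin n, T i * ∏ k, W (i k) (j k)

/-- `T[v]^j`: fix the first `j` arguments of `T` to the vector `v`,
yielding a `(q-j)`-tensor. -/
def fixMany {n q : ℕ} (T : Tensor n q) (v : Fin n → ℝ) (j : ℕ) : Tensor n (q - j) :=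
  fun idx => ∑ i : Fin j → Fin n, (∏ k, v (i k)) *
    T (fun k => if h : (k : ℕ) < j then i ⟨k, h⟩
        else idx ⟨(k : ℕ) - j, by have hk := k.isLt; omega⟩)

/-- The outer product of two tensors. -/
def outer {n a b : ℕ} (T : Tensor n a) (S : Tensor n b) : Tensor n (a + b) :=
  fun idx => T (fun k => idx (Fin.castAdd b k)) * S (fun k => idx (Fin.natAdd a k))

/-- Reindexing a tensor along an equality of orders. -/
def castOrder {n a b : ℕ} (h : a = b) (T : Tensor n a) : Tensor n b :=
  fun idx => T (fun k => idx (Fin.cast h k))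

/-- Apply a matrix to the first argument of a tensor only. -/
def applyFirst {n q : ℕ} (hq : 0 < q) (T : Tensor n q) (M : Matrix (Fin n) (Fin n) ℝ) :
    Tensor n q :=
  fun idx => ∑ i : Fin n, M i (idx ⟨0, hq⟩) * T (Function.update idx ⟨0, hq⟩ i)

end Tensor

/-- `⊗^j v`, the `j`-fold outer product of a vector `v` with itself. -/
def vpow {n : ℕ} (j : ℕ) (v : Fin n → ℝ) : Tensor n j := fun idx => ∏ k, v (idx k)

/-- The Euclidean (2-) norm of a vector in `ℝ^n`. -/
def vnorm {n : ℕ} (v : Fin n → ℝ) : ℝ := Real.sqrt (∑ i, v i ^ 2)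

/-- The injective (2-) norm of a tensor:
the supremum of `|T[u_1,…,u_q]|` over unit vectors. -/
def Tensor.inj2Norm {n q : ℕ} (T : Tensor n q) : ℝ :=
  sSup ((fun u => |T.eval u|) '' {u : Fin q → Fin n → ℝ | ∀ k, vnorm (u k) = 1})

/-- The spectral (operator 2-) norm of a matrix. -/
def specNorm {n : ℕ} (M : Matrix (Fin n) (Fin n) ℝ) : ℝ :=
  ‖Matrix.toEuclideanCLM (𝕜 := ℝ) M‖

/-- The orthogonal projection `I - w wᵀ / (wᵀ w)` onto the orthogonal complement of `w`. -/
def projPerp {n : ℕ} (w : Fin n → ℝ) : Matrix (Fin n) (Fin n) ℝ :=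
  1 - (w ⬝ᵥ w)⁻¹ • Matrix.vecMulVec w w

/-- `Cp` is a least-change symmetric update of `Cb` in the `W`-weighted Frobenius norm,
subject to the secant equation `Cp[s] = R`. -/
def IsSecantUpdate {n p : ℕ} (Cb : Tensor n p) (R : Tensor n (p - 1))
    (W : Matrix (Fin n) (Fin n) ℝ) (s : Fin n → ℝ) (Cp : Tensor n p) : Prop :=
  Cp.Symm ∧ Cp.fixMany s 1 = R ∧
    ∀ C : Tensor n p, C.Symm → C.fixMany s 1 = R →
      ((Cp - Cb).applyMat W).frobNorm ≤ ((C - Cb).applyMat W).frobNorm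

/-- The explicit higher-order secant update formula of Theorem 1 (b):
`C• + ∑_{j=1}^p (-1)^{j+1} C(p,j) (vᵀs)^{-j} P_sym((⊗^j v) ⊗ (C̃ - C•)[s]^j)`. -/
def hosuFormula {n p : ℕ} (Cb Ct : Tensor n p) (v s : Fin n → ℝ) : Tensor n p :=
  Cb + ∑ j ∈ (Finset.Icc 1 p).attach,
    ((-1 : ℝ) ^ ((j : ℕ) + 1) * (p.choose (j : ℕ) : ℝ) * ((v ⬝ᵥ s) ^ (j : ℕ))⁻¹) •
      Tensor.castOrder (Nat.add_sub_cancel' (Finset.mem_Icc.mp j.2).2)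
        (Tensor.psym ((vpow (j : ℕ) v).outer ((Ct - Cb).fixMany s (j : ℕ))))

/-- The coefficient array of the `q`-th derivative of `f : ℝ^n → ℝ`
(domain given the sup-norm product structure). -/
def derivTensorPi {n : ℕ} (q : ℕ) (f : (Fin n → ℝ) → ℝ) (x : Fin n → ℝ) : Tensor n q :=
  fun idx => iteratedFDeriv ℝ q f x (fun k => Pi.single (idx k) 1)

/-- The coefficient array of the `q`-th derivative of `f : ℝ^n → ℝ`
(domain given the Euclidean structure). -/
def derivTensorE {n : ℕ} (q : ℕ) (f : EuclideanSpace ℝ (Fin n) → ℝ)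
    (x : EuclideanSpace ℝ (Fin n)) : Tensor n q :=
  fun idx => iteratedFDeriv ℝ q f x (fun k => EuclideanSpace.single (idx k) 1)

/-- Reinterpret a Euclidean vector as a plain vector in `Fin n → ℝ`. -/
def toVec {n : ℕ} (y : EuclideanSpace ℝ (Fin n)) : Fin n → ℝ := y

namespace Tensor

variable {n q : ℕ}

lemma fixMany_one_apply (T : Tensor n (q + 1)) (v : Fin n → ℝ) (idx : Fin q → Fin n) :
    T.fixMany v 1 idx = ∑ a, v a * T (Fin.cons a idx) := by
  unfold fixMany
  rw [← (Equiv.funUnique (Fin 1) (Fin n)).symm.sum_comp]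
  refine Finset.sum_congr rfl fun a _ => ?_
  simp only [Finset.univ_unique, Finset.prod_singleton]
  congr 2
  funext k
  refine Fin.cases ?_ (fun k => ?_) k <;> simp

lemma fixMany_one_sub (T S : Tensor n (q + 1)) (v : Fin n → ℝ) :
    (T - S).fixMany v 1 = T.fixMany v 1 - S.fixMany v 1 := by
  ext idx
  rw [fixMany_one_apply]
  simp only [Pi.sub_apply]
  rw [fixMany_one_apply, fixMany_one_apply, ← Finset.sum_sub_distrib]
  exact Finset.sum_congr rfl fun a _ => by ring

lemma fixMany_one_zero (T : Tensor n (q + 1)) : T.fixMany 0 1 = 0 := by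
  ext idx
  rw [fixMany_one_apply]
  simp

lemma applyMat_sub (T S : Tensor n q) (M : Matrix (Fin n) (Fin n) ℝ) :
    (T - S).applyMat M = T.applyMat M - S.applyMat M := by
  ext j
  simp [applyMat, sub_mul]

lemma zero_applyMat (M : Matrix (Fin n) (Fin n) ℝ) : (0 : Tensor n q).applyMat M = 0 := by
  ext j
  simp [applyMat]

lemma applyMat_applyMat (T : Tensor n q) (A B : Matrix (Fin n) (Fin n) ℝ) :
    (T.applyMat A).applyMat B = T.applyMat (A * B) := by
  ext j
  simp only [applyMat, Matrix.mul_apply, Finset.prod_univ_sum, Fintype.piFinset_univ,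
    Finset.sum_mul, Finset.mul_sum, Finset.prod_mul_distrib]
  rw [Finset.sum_comm]
  simp only [mul_assoc]

lemma applyMat_one (T : Tensor n q) : T.applyMat 1 = T := by
  ext j
  unfold applyMat
  rw [Finset.sum_eq_single j]
  · simp
  · intro i _ hij
    obtain ⟨k, hk⟩ := Function.ne_iff.mp hij
    exact mul_eq_zero_of_right _
      (Finset.prod_eq_zero (Finset.mem_univ k) (Matrix.one_apply_ne hk))
  · simp

lemma Symm.applyMat {T : Tensor n q} (hT : T.Symm) (M : Matrix (Fin n) (Fin n) ℝ) :
    (T.applyMat M).Symm := by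
  intro σ j
  unfold Tensor.applyMat
  rw [← (σ.symm.arrowCongr (Equiv.refl (Fin n))).sum_comp]
  refine Finset.sum_congr rfl fun i _ => ?_
  have hi : σ.symm.arrowCongr (Equiv.refl (Fin n)) i = i ∘ σ := by
    ext k
    simp [Equiv.arrowCongr]
  rw [hi, hT σ i]
  congr 1
  exact Equiv.prod_comp σ fun k => M (i k) (j k)

lemma Symm.add {T S : Tensor n q} (hT : T.Symm) (hS : S.Symm) : (T + S).Symm := fun σ i => by
  simp [hT σ i, hS σ i]

lemma Symm.sub {T S : Tensor n q} (hT : T.Symm) (hS : S.Symm) : (T - S).Symm := fun σ i => by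
  simp [hT σ i, hS σ i]

lemma applyMat_cons (T : Tensor n (q + 1)) (M : Matrix (Fin n) (Fin n) ℝ)
    (b : Fin n) (j : Fin q → Fin n) :
    T.applyMat M (Fin.cons b j) =
      ∑ a, M a b * applyMat (fun i : Fin q → Fin n => T (Fin.cons a i)) M j := by
  unfold applyMat
  rw [← (Fin.consEquiv fun _ => Fin n).sum_comp, Fintype.sum_prod_type]
  refine Finset.sum_congr rfl fun a _ => ?_
  rw [Finset.mul_sum]
  refine Finset.sum_congr rfl fun i _ => ?_
  change T (Fin.cons a i) * ∏ k, M (Fin.cons (α := fun _ => Fin n) a i k) _ = _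
  simp only [Fin.prod_univ_succ, Fin.cons_zero, Fin.cons_succ]
  ring

lemma fixMany_one_applyMat (T : Tensor n (q + 1)) (M : Matrix (Fin n) (Fin n) ℝ)
    (v : Fin n → ℝ) :
    (T.applyMat M).fixMany v 1 = applyMat (T.fixMany (M *ᵥ v) 1) M := by
  refine funext fun (idx : Fin q → Fin n) => ?_
  refine (fixMany_one_apply _ _ _).trans ?_
  change _ = ∑ i : Fin q → Fin n, T.fixMany (M *ᵥ v) 1 i * ∏ k, M (i k) (idx k)
  have h (i : Fin q → Fin n) : T.fixMany (M *ᵥ v) 1 i =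
      ∑ a, (M *ᵥ v) a * T (Fin.cons a i) := fixMany_one_apply _ _ i
  simp only [applyMat_cons]
  simp only [h, applyMat, Finset.sum_mul, Matrix.mulVec, dotProduct, Finset.mul_sum]
  rw [Finset.sum_comm]
  conv_rhs => rw [Finset.sum_comm]
  refine Finset.sum_congr rfl fun a _ => ?_
  rw [Finset.sum_comm]
  exact Finset.sum_congr rfl fun i _ => Finset.sum_congr rfl fun b _ => by ring

lemma finner_applyMat (T S : Tensor n q) (M : Matrix (Fin n) (Fin n) ℝ) :
    (T.applyMat M).finner S = T.finner (S.applyMat Mᵀ) := by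
  simp only [finner, applyMat, Finset.sum_mul, Finset.mul_sum, Matrix.transpose_apply]
  rw [Finset.sum_comm]
  refine Finset.sum_congr rfl fun i _ => Finset.sum_congr rfl fun j _ => ?_
  ring

/-- A tensor whose contraction with `v` vanishes in every slot is unchanged by applying a
matrix which differs from the identity by a rank-one matrix with range spanned by `v`. -/
lemma applyMat_one_add_vecMulVec (v u : Fin n → ℝ) : ∀ {q : ℕ} (T : Tensor n q),
    (∀ (k : Fin q) (i : Fin q → Fin n), ∑ a, v a * T (Function.update i k a) = 0) →
    T.applyMat (1 + Matrix.vecMulVec v u) = T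
  | 0, T, _ => by
    ext j
    simp [applyMat, Subsingleton.elim default j]
  | q + 1, T, hT => by
    have ih (a : Fin n) := applyMat_one_add_vecMulVec v u (fun i : Fin q → Fin n =>
      T (Fin.cons a i)) fun k i => by simpa only [Fin.cons_update] using hT k.succ (Fin.cons a i)
    ext j
    rw [← Fin.cons_self_tail j, applyMat_cons]
    simp only [ih, Matrix.add_apply, Matrix.vecMulVec_apply, Matrix.one_apply, add_mul,
      Finset.sum_add_distrib, ite_mul, one_mul, zero_mul, Finset.sum_ite_eq', Finset.mem_univ,
      if_true]
    have hj (a : Fin n) : Function.update j 0 a = Fin.cons a (Fin.tail j) := by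
      conv_lhs => rw [← Fin.cons_self_tail j]
      exact Fin.update_cons_zero (α := fun _ => Fin n) (j 0) (Fin.tail j) a
    have h : ∑ a, v a * T (Fin.cons a (Fin.tail j)) = 0 :=
      (Finset.sum_congr rfl fun a _ => by rw [← hj a]).trans (hT 0 j)
    rw [add_eq_left]
    rw [← zero_mul (u (j 0)), ← h, Finset.sum_mul]
    exact Finset.sum_congr rfl fun a _ => by ring

lemma Symm.sum_mul_update_eq_zero {T : Tensor n (q + 1)} (hT : T.Symm) {v : Fin n → ℝ}
    (hv : T.fixMany v 1 = 0) (k : Fin (q + 1)) (i : Fin (q + 1) → Fin n) :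
    ∑ a, v a * T (Function.update i k a) = 0 := by
  have h : ∑ a, v a * T (Fin.cons a (Fin.tail (i ∘ Equiv.swap 0 k))) = 0 :=
    (fixMany_one_apply T v _).symm.trans (congrFun hv _)
  rw [← h]
  refine Finset.sum_congr rfl fun a _ => ?_
  rw [← hT (Equiv.swap 0 k)]
  congr 2
  funext l
  refine Fin.cases ?_ (fun l => ?_) l
  · simp
  · have hl : Equiv.swap 0 k l.succ ≠ k := by
      rw [Ne, Equiv.swap_apply_eq_iff, Equiv.swap_apply_right]
      exact Fin.succ_ne_zero l
    simp [Function.update_of_ne hl, Fin.tail]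

lemma Symm.applyMat_projPerp {T : Tensor n (q + 1)} (hT : T.Symm) {w : Fin n → ℝ}
    (hw : T.fixMany w 1 = 0) : T.applyMat (projPerp w) = T := by
  have h : projPerp w = 1 + Matrix.vecMulVec w (-(w ⬝ᵥ w)⁻¹ • w) := by
    rw [projPerp, Matrix.vecMulVec_smul, neg_smul, sub_eq_add_neg]
  rw [h]
  exact applyMat_one_add_vecMulVec _ _ T (hT.sum_mul_update_eq_zero hw)

lemma frobNorm_sq (T : Tensor n q) : T.frobNorm ^ 2 = T.finner T := by
  rw [frobNorm, Real.sq_sqrt (Finset.sum_nonneg fun _ _ => sq_nonneg _)]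
  exact Finset.sum_congr rfl fun _ _ => sq _

lemma eq_zero_of_finner_self_nonpos {T : Tensor n q} (h : T.finner T ≤ 0) : T = 0 := by
  have h0 : ∀ i ∈ Finset.univ, 0 ≤ T i * T i := fun i _ => mul_self_nonneg _
  have := (Finset.sum_eq_zero_iff_of_nonneg h0).mp (le_antisymm h (Finset.sum_nonneg h0))
  ext i
  exact mul_self_eq_zero.mp (this i (Finset.mem_univ i))

lemma finner_add_self (T S : Tensor n q) :
    (T + S).finner (T + S) = T.finner T + 2 * T.finner S + S.finner S := by
  simp only [finner, Pi.add_apply, Finset.mul_sum, ← Finset.sum_add_distrib]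
  exact Finset.sum_congr rfl fun _ _ => by ring

lemma finner_sub_left (T S R : Tensor n q) : (T - S).finner R = T.finner R - S.finner R := by
  simp only [finner, Pi.sub_apply, sub_mul, Finset.sum_sub_distrib]

lemma eq_zero_of_applyMat_eq_zero {T : Tensor n q} {W : Matrix (Fin n) (Fin n) ℝ}
    (hW : IsUnit W.det) (h : T.applyMat W = 0) : T = 0 := by
  rw [← applyMat_one T, ← Matrix.mul_nonsing_inv W hW, ← applyMat_applyMat, h, zero_applyMat]

end Tensor

lemma projPerp_transpose {n : ℕ} (w : Fin n → ℝ) : (projPerp w)ᵀ = projPerp w := by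
  simp [projPerp, Matrix.transpose_vecMulVec]

lemma projPerp_mulVec {n : ℕ} (w v : Fin n → ℝ) :
    projPerp w *ᵥ v = v - ((w ⬝ᵥ w)⁻¹ * (w ⬝ᵥ v)) • w := by
  ext i
  simp [projPerp, Matrix.sub_mulVec, Matrix.smul_mulVec, Matrix.vecMulVec_mulVec]
  ring

/-- For consistent secant data, the least-change update acts on the error by composing it with
the `W`-conjugate of an orthogonal projection. -/
lemma IsSecantUpdate.sub_eq_applyMat {n q : ℕ} {Cb Cst Cp : Tensor n (q + 1)}
    {W : Matrix (Fin n) (Fin n) ℝ} (hW : IsUnit W.det) {s : Fin n → ℝ} (hs : s ≠ 0)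
    (hCb : Cb.Symm) (hCst : Cst.Symm) (h : IsSecantUpdate Cb (Cst.fixMany s 1) W s Cp) :
    Cp - Cst = (Cb - Cst).applyMat (W * projPerp (W⁻¹ *ᵥ s) * W⁻¹) := by
  obtain ⟨hCp, hsec, hmin⟩ := h
  set w := W⁻¹ *ᵥ s with hw
  have hWw : W *ᵥ w = s := by
    rw [hw, Matrix.mulVec_mulVec, Matrix.mul_nonsing_inv W hW, Matrix.one_mulVec]
  have hw0 : w ⬝ᵥ w ≠ 0 := by
    rw [Ne, dotProduct_self_eq_zero]
    intro h0
    exact hs (by rw [← hWw, h0, Matrix.mulVec_zero])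
  set E := Cb - Cst
  set F := E.applyMat (W * projPerp w * W⁻¹) with hF
  have hE : E.Symm := hCb.sub hCst
  have hFs : F.fixMany s 1 = 0 := by
    rw [hF, Tensor.fixMany_one_applyMat, ← Matrix.mulVec_mulVec, ← hw, ← Matrix.mulVec_mulVec,
      projPerp_mulVec, inv_mul_cancel₀ hw0, one_smul, sub_self, Matrix.mulVec_zero,
      Tensor.fixMany_one_zero, Tensor.zero_applyMat]
  have hFW : F.applyMat W = (E.applyMat W).applyMat (projPerp w) := by
    rw [hF, Tensor.applyMat_applyMat, Tensor.applyMat_applyMat,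
      Matrix.nonsing_inv_mul_cancel_right _ _ hW]
  set D := Cp - Cst - F with hD
  have hDs : D.fixMany s 1 = 0 := by
    rw [hD, Tensor.fixMany_one_sub, Tensor.fixMany_one_sub, hsec, hFs, sub_self, sub_zero]
  have hDsymm : D.Symm := (hCp.sub hCst).sub (hE.applyMat _)
  have hDP : (D.applyMat W).applyMat (projPerp w) = D.applyMat W := by
    refine (hDsymm.applyMat W).applyMat_projPerp ?_
    rw [Tensor.fixMany_one_applyMat, hWw, hDs, Tensor.zero_applyMat]
  have horth : ((F - E).applyMat W).finner (D.applyMat W) = 0 := by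
    rw [Tensor.applyMat_sub, Tensor.finner_sub_left, hFW, Tensor.finner_applyMat,
      projPerp_transpose, hDP, sub_self]
  have hle := hmin (Cst + F) (hCst.add (hE.applyMat _)) (by
    rw [← sub_eq_zero, ← Tensor.fixMany_one_sub, add_sub_cancel_left, hFs])
  have hle2 := pow_le_pow_left₀ (Real.sqrt_nonneg _) hle 2
  have e1 : Cst + F - Cb = F - E := by simp only [E]; abel
  have e2 : (Cp - Cb).applyMat W = (F - E).applyMat W + D.applyMat W := by
    rw [← sub_eq_iff_eq_add, ← Tensor.applyMat_sub]
    congr 1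
    simp only [hD, E]
    abel
  change Tensor.frobNorm _ ^ 2 ≤ _ at hle2
  rw [Tensor.frobNorm_sq, Tensor.frobNorm_sq, e1, e2, Tensor.finner_add_self, horth] at hle2
  exact sub_eq_zero.mp (Tensor.eq_zero_of_applyMat_eq_zero hW
    (Tensor.eq_zero_of_finner_self_nonpos (by linarith)))

/-- A tensor whose contractions with `n` linearly independent vectors of `ℝ^n` vanish is zero. -/
lemma Tensor.eq_zero_of_fixMany_eq_zero {n q : ℕ} {T : Tensor n (q + 1)}
    {s : Fin n → Fin n → ℝ} (hs : LinearIndependent ℝ s) (h : ∀ k, T.fixMany (s k) 1 = 0) :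
    T = 0 := by
  let φ (idx : Fin q → Fin n) : (Fin n → ℝ) →ₗ[ℝ] ℝ :=
    Fintype.linearCombination ℝ fun a => T (Fin.cons a idx)
  have hφ (idx : Fin q → Fin n) : φ idx = 0 := by
    refine LinearMap.ext_on_range (hs.span_eq_top_of_card_eq_finrank' (by simp)) fun k => ?_
    have := (Tensor.fixMany_one_apply T (s k) idx).symm.trans (congrFun (h k) idx)
    simpa [φ, Fintype.linearCombination_apply] using this
  ext i
  have := LinearMap.congr_fun (hφ (Fin.tail i)) (Pi.single (i 0) 1)
  simpa [φ, Fintype.linearCombination_apply_single] using this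

lemma linearIndependent_of_mulVec_orthogonal {m n : ℕ} (A : Matrix (Fin n) (Fin n) ℝ)
    {s : Fin m → Fin n → ℝ} (hs : ∀ k, A *ᵥ s k ≠ 0)
    (horth : ∀ k l, k ≠ l → (A *ᵥ s k) ⬝ᵥ (A *ᵥ s l) = 0) : LinearIndependent ℝ s := by
  rw [Fintype.linearIndependent_iff]
  intro g hg k
  have h := congrArg (fun v => (A *ᵥ s k) ⬝ᵥ (A *ᵥ v)) hg
  simp only [Matrix.mulVec_sum, Matrix.mulVec_smul, dotProduct_sum, dotProduct_smul,
    Matrix.mulVec_zero, dotProduct_zero] at h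
  rw [Finset.sum_eq_single k (fun l _ hl => by rw [horth k l hl.symm, smul_zero])
    (by simp)] at h
  exact (smul_eq_zero.mp h).resolve_right fun h0 => hs k (dotProduct_self_eq_zero.mp h0)

/-- if the scaled steps `W⁻¹s_k`, `k = 0, …, n-1`, are pairwise orthogonal
and the secant data comes from the constant `p`-th derivative `C_*` (a `p`-th order
polynomial objective), then after `n` higher-order secant updates `C_n = C_*`. -/
theorem statement7 (n p : ℕ) (hn : 1 ≤ n) (hp : 1 ≤ p)
    (Wst : Matrix (Fin n) (Fin n) ℝ) (hWst : IsUnit Wst.det)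
    (Cst : Tensor n p) (hCst : Cst.Symm)
    (s : Fin n → (Fin n → ℝ)) (hs : ∀ k, s k ≠ 0)
    (horth : ∀ k l : Fin n, k ≠ l → (Wst⁻¹ *ᵥ s k) ⬝ᵥ (Wst⁻¹ *ᵥ s l) = 0)
    (C : ℕ → Tensor n p) (hC0 : (C 0).Symm)
    (hupd : ∀ k : Fin n,
      IsSecantUpdate (C (k : ℕ)) (Cst.fixMany (s k) 1) Wst (s k) (C ((k : ℕ) + 1))) :
    C n = Cst := by
  obtain ⟨q, rfl⟩ := Nat.exists_eq_add_of_le' hp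
  have hWs (k : Fin n) : Wst *ᵥ (Wst⁻¹ *ᵥ s k) = s k := by
    rw [Matrix.mulVec_mulVec, Matrix.mul_nonsing_inv Wst hWst, Matrix.one_mulVec]
  have hw0 (k : Fin n) : Wst⁻¹ *ᵥ s k ≠ 0 := fun h0 =>
    hs k (by rw [← hWs k, h0, Matrix.mulVec_zero])
  have hsymm : ∀ k ≤ n, (C k).Symm
    | 0, _ => hC0
    | k + 1, hk => (hupd ⟨k, hk⟩).1
  have key : ∀ k ≤ n, ∀ j : Fin n, (j : ℕ) < k → (C k - Cst).fixMany (s j) 1 = 0 := by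
    intro k
    induction k with
    | zero => intro _ j hj; exact absurd hj (Nat.not_lt_zero _)
    | succ k ih =>
      intro hk j hj
      rcases Nat.lt_succ_iff_lt_or_eq.mp hj with hjk | rfl
      · rw [(hupd ⟨k, hk⟩).sub_eq_applyMat hWst (hs _) (hsymm k (by omega)) hCst,
          Tensor.fixMany_one_applyMat, ← Matrix.mulVec_mulVec, ← Matrix.mulVec_mulVec,
          projPerp_mulVec, horth ⟨k, hk⟩ j (Fin.ne_of_gt (Fin.lt_def.mpr hjk)), mul_zero, zero_smul,
          sub_zero, hWs,
          ih (by omega) j hjk, Tensor.zero_applyMat]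
      · rw [Tensor.fixMany_one_sub, (hupd j).2.1, sub_self]
  exact sub_eq_zero.mp (Tensor.eq_zero_of_fixMany_eq_zero
    (linearIndependent_of_mulVec_orthogonal Wst⁻¹ hw0 horth) fun k => key n le_rfl k k.isLt)
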